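/- Let ξ ∈ Z₁. Then the number of one-dimensional F-subspaces ⟨v⟩ of F⁴ such that H(v) = 2ξ·Q(v)^{(q+1)/2} and H(v) ≠ 0 is exactly (q−1)²·q²·(q+1)/2. (This is the size of the point set S̃_ξ = S_ξ \ H for ξ ∈ Z₁.) -/

import Mathlib

/-- `Q(α,β,γ,δ) = αδ - βγ`, the quadratic form of the hyperbolic quadric. -/
def Qf {F : Type*} [Field F] (v : Fin 4 → F) : F := v 0 * v 3 - v 1 * v 2

/-- `H(α,β,γ,δ) = α^{q+1} - β^{q+1} - γ^{q+1} + δ^{q+1}`, the Hermitian form. -/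
def Hf (q : ℕ) {F : Type*} [Field F] (v : Fin 4 → F) : F :=
  v 0 ^ (q + 1) - v 1 ^ (q + 1) - v 2 ^ (q + 1) + v 3 ^ (q + 1)

/-- `v = (α,β,γ,δ)` is nonsingular if `(αz + δ^q z^q)x + (γz + β^q z^q)x^q ≠ 0`
for all nonzero `x, z`. -/
def Nonsingular (q : ℕ) {F : Type*} [Field F] (v : Fin 4 → F) : Prop :=
  ∀ x z : F, x ≠ 0 → z ≠ 0 →
    (v 0 * z + v 3 ^ q * z ^ q) * x + (v 2 * z + v 1 ^ q * z ^ q) * x ^ q ≠ 0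

/-- `Δ(v) = H(v)² - 4·Q(v)^{q+1}`. -/
def Deltaf (q : ℕ) {F : Type*} [Field F] (v : Fin 4 → F) : F :=
  Hf q v ^ 2 - 4 * Qf v ^ (q + 1)

/-- A Σ-vector: a nonzero vector of the form `(α, β, β^q, α^q)`. -/
def IsSigmaVec (q : ℕ) {F : Type*} [Field F] (v : Fin 4 → F) : Prop :=
  v ≠ 0 ∧ ∃ α β : F, v = ![α, β, β ^ q, α ^ q]

/-- The sesquilinear form `h(u,v) = u₁v₁^q - u₂v₂^q - u₃v₃^q + u₄v₄^q`. -/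
def hForm (q : ℕ) {F : Type*} [Field F] (u v : Fin 4 → F) : F :=
  u 0 * v 0 ^ q - u 1 * v 1 ^ q - u 2 * v 2 ^ q + u 3 * v 3 ^ q

/-- The one-dimensional `F`-subspace (as a set) spanned by `v`. -/
def Fline {F : Type*} [Field F] (v : Fin 4 → F) : Set (Fin 4 → F) :=
  {x | ∃ a : F, x = a • v}

/-- The number of one-dimensional `𝔽_q`-subspaces `⟨(s,t)⟩` of `𝔽_q²` with
`Q(s·u + t·w) = 0`. -/
noncomputable def tangentCount (q : ℕ) {F : Type*} [Field F] (u w : Fin 4 → F) : ℕ :=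
  Set.ncard {L : Set (F × F) | ∃ s t : F, s ^ q = s ∧ t ^ q = t ∧ (s, t) ≠ (0, 0) ∧
    Qf (fun i => s * u i + t * w i) = 0 ∧
    L = {p : F × F | ∃ e : F, e ^ q = e ∧ p = (e * s, e * t)}}

/-- `Z₁`: the set of `ξ ∉ {0, 1, -1}` such that `1 - ξ⁻²` is a nonzero square of `𝔽_q`. -/
def Zone (q : ℕ) (F : Type*) [Field F] : Set F :=
  {ξ | ξ ≠ 0 ∧ ξ ≠ 1 ∧ ξ ≠ -1 ∧ ∃ s : F, s ^ q = s ∧ s ≠ 0 ∧ 1 - (ξ ^ 2)⁻¹ = s ^ 2}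

/-- `Z₂`: the set of `ξ ≠ 0` such that `1 - ξ⁻²` is a nonzero nonsquare of `𝔽_q`. -/
def Ztwo (q : ℕ) (F : Type*) [Field F] : Set F :=
  {ξ | ξ ≠ 0 ∧ (1 - (ξ ^ 2)⁻¹) ^ q = 1 - (ξ ^ 2)⁻¹ ∧ 1 - (ξ ^ 2)⁻¹ ≠ 0 ∧
    ¬∃ s : F, s ^ q = s ∧ 1 - (ξ ^ 2)⁻¹ = s ^ 2}

open Finset in
/-- A map onto `t` all of whose fibres have `c` elements multiplies the cardinality by `c`. -/
theorem Finset.card_eq_card_mul_of_card_fiber {ι κ : Type*} [DecidableEq κ] {s : Finset ι}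
    {t : Finset κ} (f : ι → κ) {c : ℕ} (hf : ∀ a ∈ s, f a ∈ t)
    (hc : ∀ b ∈ t, #{a ∈ s | f a = b} = c) : #s = #t * c := by
  rw [Finset.card_eq_sum_card_fiberwise (f := f) (t := t) hf, Finset.sum_congr rfl hc,
    Finset.sum_const, smul_eq_mul]

namespace FiniteField

open Finset

variable {F : Type*} {q : ℕ}

theorem one_lt_of_card_eq_sq [Fintype F] [Nontrivial F] (hF : Fintype.card F = q ^ 2) : 1 < q := by
  have := Fintype.one_lt_card (α := F)
  by_contra! h
  have := Nat.pow_le_pow_left h 2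
  omega

theorem card_sub_one_of_card_eq_sq [Fintype F] (hF : Fintype.card F = q ^ 2) :
    (q + 1) * (q - 1) = Fintype.card F - 1 := by
  rw [hF]
  simpa using (Nat.sq_sub_sq q 1).symm

variable [Field F] {σ : F →+* F}

theorem apply_apply_of_card_eq_sq [Fintype F] (hF : Fintype.card F = q ^ 2)
    (hσ : ∀ x, σ x = x ^ q) (x : F) : σ (σ x) = x := by
  rw [hσ, hσ, ← pow_mul, ← sq, ← hF, FiniteField.pow_card]

theorem pow_sub_one_eq_one_iff (hq : 1 < q) (hσ : ∀ x, σ x = x ^ q) {c : F} (hc : c ≠ 0) :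
    c ^ (q - 1) = 1 ↔ σ c = c := by
  obtain ⟨k, rfl⟩ : ∃ k, q = k + 1 := ⟨q - 1, by omega⟩
  rw [hσ, pow_succ, Nat.add_sub_cancel]
  constructor
  · intro h; rw [h, one_mul]
  · intro h; exact mul_right_cancel₀ hc (by rw [h, one_mul])

variable [Fintype F] [DecidableEq F]

/-- If `n * m = |F| - 1`, an `m`-th root of unity has exactly `n` roots of order `n`. -/
theorem card_pow_eq {n m : ℕ} (hnm : n * m = Fintype.card F - 1) {c : F}
    (hc : c ^ m = 1) : #{y : F | y ^ n = c} = n := by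
  have hpos : 0 < n * m := by
    rw [hnm]; have := Fintype.one_lt_card (α := F); omega
  have hn : 0 < n := Nat.pos_of_mul_pos_right hpos
  have hm : 0 < m := Nat.pos_of_mul_pos_left hpos
  have hc0 : c ≠ 0 := by
    rintro rfl
    simp [hm.ne'] at hc
  obtain ⟨g, hg⟩ := IsCyclic.exists_generator (α := Fˣ)
  have hord : orderOf g = n * m := by
    rw [orderOf_eq_card_of_forall_mem_zpowers hg, Nat.card_eq_fintype_card, Fintype.card_units, hnm]
  have hprim : IsPrimitiveRoot (g : F) (n * m) := by
    rw [IsPrimitiveRoot.coe_units_iff, ← hord]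
    exact IsPrimitiveRoot.orderOf g
  have hprim' : IsPrimitiveRoot ((g : F) ^ m) n :=
    hprim.pow hpos (mul_comm n m)
  have hex : ∃ a, a ^ n = c := by
    obtain ⟨k, hk⟩ := (mem_powers_iff_mem_zpowers.2 (hg (Units.mk0 c hc0)))
    have hk' : (g : F) ^ k = c := by
      have := congrArg Units.val hk
      simpa using this
    have : n * m ∣ k * m := by
      rw [← hprim.pow_eq_one_iff_dvd, pow_mul, hk', hc]
    obtain ⟨j, rfl⟩ := Nat.dvd_of_mul_dvd_mul_right hm this
    exact ⟨(g : F) ^ j, by rw [← hk', ← pow_mul, mul_comm]⟩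
  have h1 := hprim'.card_nthRoots c
  rw [if_pos hex] at h1
  have h2 : ({y : F | y ^ n = c} : Finset F) = (Polynomial.nthRoots n c).toFinset := by
    ext y
    simp [Polynomial.mem_nthRoots hn]
  rw [h2, Multiset.toFinset_card_of_nodup (hprim'.nthRoots_nodup hc0), h1]

theorem card_norm_eq (hF : Fintype.card F = q ^ 2) (hσ : ∀ x, σ x = x ^ q) {c : F} (hc : c ≠ 0)
    (hcσ : σ c = c) : #{x : F | x * σ x = c} = q + 1 := by
  rw [← card_pow_eq (card_sub_one_of_card_eq_sq hF)
    ((pow_sub_one_eq_one_iff (one_lt_of_card_eq_sq hF) hσ hc).2 hcσ)]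
  simp only [hσ, pow_succ' _ q]

theorem card_fixed_ne_zero (hF : Fintype.card F = q ^ 2) (hσ : ∀ x, σ x = x ^ q) :
    #{x : F | x ≠ 0 ∧ σ x = x} = q - 1 := by
  have hq := one_lt_of_card_eq_sq hF
  rw [← card_pow_eq ((mul_comm _ _).trans (card_sub_one_of_card_eq_sq hF)) (one_pow _)]
  congr 1
  ext x
  simp only [mem_filter_univ]
  constructor
  · rintro ⟨h0, h⟩
    exact (pow_sub_one_eq_one_iff hq hσ h0).2 h
  · intro h
    have h0 : x ≠ 0 := by
      rintro rfl
      rw [zero_pow (by omega)] at h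
      exact zero_ne_one h
    exact ⟨h0, (pow_sub_one_eq_one_iff hq hσ h0).1 h⟩

theorem card_trace_eq_zero (hF : Fintype.card F = q ^ 2) (hodd : Odd q) (hσ : ∀ x, σ x = x ^ q) :
    #{x : F | x + σ x = 0} = q := by
  have hq := one_lt_of_card_eq_sq hF
  have h1 := card_pow_eq (c := (-1 : F)) ((mul_comm _ _).trans (card_sub_one_of_card_eq_sq hF))
    (hodd.add_one.neg_one_pow)
  have h2 : ({x : F | x + σ x = 0} : Finset F) =
      insert 0 ({x : F | x ^ (q - 1) = -1} : Finset F) := by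
    ext x
    simp only [mem_filter_univ, mem_insert]
    obtain ⟨k, rfl⟩ : ∃ k, q = k + 2 := ⟨q - 2, by omega⟩
    rw [hσ]
    have : x + x ^ (k + 2) = x * (x ^ (k + 2 - 1) + 1) := by
      rw [show k + 2 - 1 = k + 1 by omega]; ring
    rw [this, mul_eq_zero, eq_neg_iff_add_eq_zero]
  rw [h2, card_insert_of_notMem, h1]
  · omega
  · simp [show q - 1 ≠ 0 by omega]

theorem card_trace_eq (hF : Fintype.card F = q ^ 2) (hodd : Odd q) (hσ : ∀ x, σ x = x ^ q)
    (h2 : (2 : F) ≠ 0) {c : F} (hc : σ c = c) : #{x : F | x + σ x = c} = q := by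
  rw [← card_trace_eq_zero hF hodd hσ]
  have hs : σ (c / 2) = c / 2 := by rw [map_div₀, hc, map_ofNat]
  have hc2 : c / 2 + c / 2 = c := by field_simp; ring
  refine card_bij' (fun x _ ↦ x - c / 2) (fun x _ ↦ x + c / 2) ?_ ?_ (by simp) (by simp)
  · intro x hx
    simp only [mem_filter_univ, map_sub, hs] at hx ⊢
    linear_combination hx - hc2
  · intro x hx
    simp only [mem_filter_univ, map_add, hs] at hx ⊢
    linear_combination hx + hc2

theorem card_mul_pow_half_eq (hF : Fintype.card F = q ^ 2) (hσ : ∀ x, σ x = x ^ q) {n : ℕ}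
    (hn : q + 1 = 2 * n) {ξ m : F} (hξ : ξ ≠ 0) (hξσ : σ (ξ ^ 2) = ξ ^ 2) (hm : m ≠ 0)
    (hmσ : σ m = m) : #{y : F | ξ * y ^ n = m} = n := by
  have hq := one_lt_of_card_eq_sq hF
  have h := card_sub_one_of_card_eq_sq hF
  rw [hn, mul_comm 2 n, mul_assoc] at h
  have hset : ({y : F | ξ * y ^ n = m} : Finset F) =
      ({y : F | y ^ n = m / ξ} : Finset F) := by
    ext y
    simp only [mem_filter_univ]
    rw [eq_div_iff hξ, mul_comm]
  rw [hset, card_pow_eq h]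
  rw [pow_mul, pow_sub_one_eq_one_iff hq hσ (by positivity), div_pow, map_div₀, hξσ, map_pow, hmσ]


theorem card_fixed_mul_pow_half (hF : Fintype.card F = q ^ 2) (hσ : ∀ x, σ x = x ^ q) {n : ℕ}
    (hn : q + 1 = 2 * n) {ξ : F} (hξ : ξ ≠ 0) (hξσ : σ (ξ ^ 2) = ξ ^ 2) :
    #{y : F | y ≠ 0 ∧ σ (ξ * y ^ n) = ξ * y ^ n} = (q - 1) * n := by
  rw [← card_fixed_ne_zero hF hσ]
  refine card_eq_card_mul_of_card_fiber (fun y ↦ ξ * y ^ n) ?_ ?_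
  · intro y hy
    simp only [mem_filter_univ] at hy ⊢
    exact ⟨mul_ne_zero hξ (pow_ne_zero _ hy.1), hy.2⟩
  · intro m hm
    rw [mem_filter_univ] at hm
    rw [filter_filter]
    refine Eq.trans (congrArg Finset.card ?_) (card_mul_pow_half_eq hF hσ hn hξ hξσ hm.1 hm.2)
    ext y
    simp only [mem_filter_univ]
    constructor
    · exact fun h ↦ h.2
    · rintro rfl
      refine ⟨⟨?_, hm.2⟩, rfl⟩
      rintro rfl
      exact hm.1 (by rw [zero_pow (by omega), mul_zero])

theorem card_completions_of_isotropic (hF : Fintype.card F = q ^ 2) (hodd : Odd q)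
    (hσ : ∀ x, σ x = x ^ q) (h2 : (2 : F) ≠ 0) {n : ℕ} (hn : q + 1 = 2 * n) {ξ : F} (hξ : ξ ≠ 0)
    (hξσ : σ (ξ ^ 2) = ξ ^ 2) {a b : F} (ha : a ≠ 0) (hab : a * σ a = b * σ b) :
    #{p : F × F | a * p.2 - b * p.1 ≠ 0 ∧ a * σ a - b * σ b - p.1 * σ p.1 + p.2 * σ p.2 =
      2 * ξ * (a * p.2 - b * p.1) ^ n} = (q - 1) * n * q := by
  have hinv := apply_apply_of_card_eq_sq hF hσ
  have hσa : σ a ≠ 0 := by simpa using ha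
  have hb : b ≠ 0 := by
    rintro rfl
    simp [ha] at hab
  rw [← card_fixed_mul_pow_half hF hσ hn hξ hξσ]
  refine card_eq_card_mul_of_card_fiber (fun p ↦ a * p.2 - b * p.1) ?_ ?_
  · rintro ⟨c, d⟩ hp
    simp only [mem_filter_univ] at hp ⊢
    refine ⟨hp.1, ?_⟩
    have hval : ξ * (a * d - b * c) ^ n = (a * σ a - b * σ b - c * σ c + d * σ d) / 2 := by
      rw [hp.2]; field_simp
    rw [hval]
    simp only [map_div₀, map_ofNat, map_sub, map_add, map_mul, hinv]
    ring
  · intro y hy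
    simp only [mem_filter_univ] at hy
    obtain ⟨hy0, hy⟩ := hy
    have hσy : σ y ≠ 0 := by simpa using hy0
    have hfix : σ (2 * (ξ * y ^ n) * (a * σ a) - y * σ y) =
        2 * (ξ * y ^ n) * (a * σ a) - y * σ y := by
      rw [map_sub, map_mul, map_mul σ 2, hy]
      simp only [map_mul, hinv, map_ofNat]
      ring
    rw [← card_trace_eq hF hodd hσ h2 hfix, filter_filter]
    refine card_bij' (fun p _ ↦ σ y * b * p.1)
      (fun x _ ↦ (x / (σ y * b), (y + x / σ y) / a)) ?_ ?_ ?_ ?_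
    · rintro ⟨c, d⟩ hp
      simp only [mem_filter_univ] at hp ⊢
      obtain ⟨⟨-, hH⟩, hQ⟩ := hp
      have hQσ : σ a * σ d - σ b * σ c = σ y := by rw [← hQ]; simp
      rw [hQ] at hH
      simp only [map_mul, hinv]
      linear_combination (a * σ a) * hH + (c * σ c - a * σ a) * hab - a * d * hQσ -
        (σ y + σ b * σ c) * hQ
    · intro x hx
      simp only [mem_filter_univ] at hx ⊢
      have hQ : a * ((y + x / σ y) / a) - b * (x / (σ y * b)) = y := by
        field_simp; ring
      have hσb : σ b ≠ 0 := by simpa using hb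
      refine ⟨⟨by rwa [hQ], ?_⟩, hQ⟩
      rw [hQ]
      simp only [map_mul, map_div₀, map_add, hinv]
      have hbb : x / (σ y * b) * (σ x / (y * σ b)) = x * σ x / (σ y * y * (a * σ a)) := by
        rw [hab]; field_simp
      have hH : (0 : F) - x * σ x / (σ y * y * (a * σ a)) +
          (y + x / σ y) / a * ((σ y + σ x / y) / σ a) = (x + σ x + y * σ y) / (a * σ a) := by
        field_simp
        ring
      rw [hbb, ← hab, sub_self, hH, div_eq_iff (mul_ne_zero ha hσa)]
      linear_combination hx
    · rintro ⟨c, d⟩ hp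
      simp only [mem_filter_univ] at hp
      obtain ⟨-, hQ⟩ := hp
      ext
      · field_simp
      · field_simp
        linear_combination -hQ
    · intro x _
      field_simp

theorem card_roots_of_sq {ξ s : F} (h2 : (2 : F) ≠ 0) (hξ : ξ ≠ 0) (hs0 : s ≠ 0) (hsσ : σ s = s)
    (hs : 1 - (ξ ^ 2)⁻¹ = s ^ 2) (hξσ : σ (ξ ^ 2) = ξ ^ 2) :
    #{m : F | (m ≠ 0 ∧ σ m = m) ∧ 1 + m ^ 2 / ξ ^ 2 - 2 * m = 0} = 2 := by
  have hs' : ξ ^ 2 * s ^ 2 = ξ ^ 2 - 1 := by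
    rw [← hs]; field_simp
  have hset : ({m : F | (m ≠ 0 ∧ σ m = m) ∧ 1 + m ^ 2 / ξ ^ 2 - 2 * m = 0} : Finset F) =
      {ξ ^ 2 * (1 + s), ξ ^ 2 * (1 - s)} := by
    ext m
    simp only [mem_filter_univ, mem_insert, mem_singleton]
    have hfac : ξ ^ 2 * (1 + m ^ 2 / ξ ^ 2 - 2 * m) =
        (m - ξ ^ 2 * (1 + s)) * (m - ξ ^ 2 * (1 - s)) := by
      field_simp
      linear_combination ξ ^ 2 * hs'
    have hiff : 1 + m ^ 2 / ξ ^ 2 - 2 * m = 0 ↔ m = ξ ^ 2 * (1 + s) ∨ m = ξ ^ 2 * (1 - s) := by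
      rw [← mul_eq_zero_iff_left (pow_ne_zero 2 hξ), hfac,
        mul_eq_zero, sub_eq_zero, sub_eq_zero]
    rw [hiff]
    refine ⟨fun h ↦ h.2, fun h ↦ ⟨⟨?_, ?_⟩, h⟩⟩
    · rintro rfl
      rw [← hiff] at h
      simp at h
    · rcases h with rfl | rfl <;> rw [map_mul, hξσ] <;> simp [hsσ]
  rw [hset, card_pair]
  intro h
  have h3 := mul_left_cancel₀ (pow_ne_zero 2 hξ) h
  exact mul_ne_zero h2 hs0 (by linear_combination h3)

theorem card_completions_of_anisotropic (hF : Fintype.card F = q ^ 2)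
    (hσ : ∀ x, σ x = x ^ q) (h2 : (2 : F) ≠ 0) {n : ℕ} (hn : q + 1 = 2 * n) {ξ s : F} (hξ : ξ ≠ 0)
    (hs0 : s ≠ 0) (hsσ : σ s = s)
    (hs : 1 - (ξ ^ 2)⁻¹ = s ^ 2)
    (hξσ : σ (ξ ^ 2) = ξ ^ 2) {a b : F} (hab : a * σ a ≠ b * σ b) :
    #{p : F × F | a * p.2 - b * p.1 ≠ 0 ∧ a * σ a - b * σ b - p.1 * σ p.1 + p.2 * σ p.2 =
      2 * ξ * (a * p.2 - b * p.1) ^ n} = n * (2 + (q - 3) * (q + 1)) := by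
  have hinv := apply_apply_of_card_eq_sq hF hσ
  obtain ⟨A, hA⟩ : ∃ A, A = a * σ a - b * σ b := ⟨_, rfl⟩
  have hA0 : A ≠ 0 := by rw [hA]; exact sub_ne_zero.2 hab
  have hAσ : σ A = A := by
    rw [hA]; simp only [map_sub, map_mul, hinv]; ring
  have hfiber : ∀ m ∈ ({m : F | m ≠ 0 ∧ σ m = m} : Finset F),
      #{p ∈ ({p : F × F | a * p.2 - b * p.1 ≠ 0 ∧ a * σ a - b * σ b - p.1 * σ p.1 + p.2 * σ p.2 =
        2 * ξ * (a * p.2 - b * p.1) ^ n} : Finset (F × F)) | ξ * (a * p.2 - b * p.1) ^ n / A = m} =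
      n * if 1 + m ^ 2 / ξ ^ 2 - 2 * m = 0 then 1 else q + 1 := by
    intro m hm
    simp only [mem_filter_univ] at hm
    obtain ⟨hm0, hmσ⟩ := hm
    have hx : #{x : F | x * σ x = 1 + m ^ 2 / ξ ^ 2 - 2 * m} =
        if 1 + m ^ 2 / ξ ^ 2 - 2 * m = 0 then 1 else q + 1 := by
      split_ifs with h
      · rw [h, card_eq_one]
        exact ⟨0, by ext; simp⟩
      · refine card_norm_eq hF hσ h ?_
        rw [map_sub, map_add, map_div₀, hξσ, map_mul, map_pow, hmσ, map_one, map_ofNat]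
    have hy : #{y : F | ξ * y ^ n = m * A} = n :=
      card_mul_pow_half_eq hF hσ hn hξ hξσ (mul_ne_zero hm0 hA0) (by rw [map_mul, hmσ, hAσ])
    rw [← hx, filter_filter]
    refine Eq.trans ?_ ((card_product _ _).trans (congrArg (· * _) hy))
    have hnorm : ∀ y, ξ * y ^ n = m * A → y * σ y = m ^ 2 / ξ ^ 2 * A ^ 2 := by
      intro y hy
      rw [hσ, ← pow_succ', hn, mul_comm, pow_mul]
      have : y ^ n = m * A / ξ := by rw [eq_div_iff hξ, mul_comm, hy]
      rw [this]; field_simp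
    refine card_bij' (fun p _ ↦ (a * p.2 - b * p.1, (p.1 * σ a - p.2 * σ b) / A))
      (fun z _ ↦ (z.2 * a + z.1 / A * σ b, z.2 * b + z.1 / A * σ a)) ?_ ?_ ?_ ?_
    · rintro ⟨c, d⟩ hp
      simp only [mem_filter_univ, mem_product] at hp ⊢
      obtain ⟨⟨-, hH⟩, hQ⟩ := hp
      rw [div_eq_iff hA0] at hQ
      refine ⟨hQ, ?_⟩
      have h1 := hnorm _ hQ
      rw [mul_assoc, hQ, ← hA] at hH
      simp only [map_sub, map_div₀, map_mul, hinv, hAσ] at h1 ⊢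
      rw [div_mul_div_comm, div_eq_iff (mul_ne_zero hA0 hA0)]
      linear_combination h1 - A * hH + (d * σ d - c * σ c) * hA
    · rintro ⟨y, x⟩ hz
      simp only [mem_filter_univ, mem_product] at hz ⊢
      obtain ⟨hy, hx⟩ := hz
      have hQ : a * (x * b + y / A * σ a) - b * (x * a + y / A * σ b) = y := by
        field_simp
        rw [hA]; ring
      have h1 := hnorm _ hy
      rw [hQ]
      refine ⟨⟨?_, ?_⟩, by rw [hy, mul_div_cancel_right₀ _ hA0]⟩
      · rintro rfl
        rw [zero_pow (by omega), mul_zero] at hy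
        exact mul_ne_zero hm0 hA0 hy.symm
      · rw [mul_assoc, hy]
        simp only [map_add, map_mul, map_div₀, hinv, hAσ]
        rw [← hA]
        have : A - (x * a + y / A * σ b) * (σ x * σ a + σ y / A * b) +
          (x * b + y / A * σ a) * (σ x * σ b + σ y / A * a) = A - (x * σ x) * A + y * σ y / A := by
          rw [eq_comm]
          field_simp
          rw [hA]
          ring
        rw [this, hx, h1]
        field_simp
        ring
    · rintro ⟨c, d⟩ _
      ext
      · field_simp
        rw [hA]
        ring
      · field_simp
        rw [hA]
        ring
    · rintro ⟨y, x⟩ _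
      simp only [Prod.mk.injEq]
      constructor
      · field_simp
        rw [hA]
        ring
      · field_simp
        rw [hA]
        ring
  rw [card_eq_sum_card_fiberwise (t := ({m : F | m ≠ 0 ∧ σ m = m} : Finset F)) ?_,
    sum_congr rfl hfiber, ← mul_sum, sum_ite, sum_const, sum_const, filter_filter,
    card_roots_of_sq h2 hξ hs0 hsσ hs hξσ]
  · have h1 := card_filter_add_card_filter_not (s := ({m : F | m ≠ 0 ∧ σ m = m} : Finset F))
      (fun m ↦ 1 + m ^ 2 / ξ ^ 2 - 2 * m = 0)
    rw [card_fixed_ne_zero hF hσ, filter_filter, card_roots_of_sq h2 hξ hs0 hsσ hs hξσ] at h1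
    rw [smul_eq_mul, smul_eq_mul, mul_one, Nat.eq_sub_of_add_eq' h1, Nat.sub_sub]
  · rintro ⟨c, d⟩ hp
    simp only [coe_filter, mem_univ, true_and, Set.mem_ofPred_eq] at hp ⊢
    obtain ⟨hQ, hH⟩ := hp
    refine ⟨div_ne_zero (mul_ne_zero hξ (pow_ne_zero _ hQ)) hA0, ?_⟩
    rw [map_div₀, hAσ]
    have hval : ξ * (a * d - b * c) ^ n = (a * σ a - b * σ b - c * σ c + d * σ d) / 2 := by
      rw [hH]; field_simp
    rw [hval]
    simp only [map_div₀, map_ofNat, map_sub, map_add, map_mul, hinv]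
    ring

theorem card_isotropic (hF : Fintype.card F = q ^ 2) (hσ : ∀ x, σ x = x ^ q) :
    #{r : F × F | r.1 ≠ 0 ∧ r.1 * σ r.1 = r.2 * σ r.2} = (q ^ 2 - 1) * (q + 1) := by
  have hinv := apply_apply_of_card_eq_sq hF hσ
  have h0 : #{a : F | a ≠ 0} = q ^ 2 - 1 := by
    rw [filter_ne', card_erase_of_mem (mem_univ _), card_univ, hF]
  rw [← h0]
  refine card_eq_card_mul_of_card_fiber Prod.fst (fun r hr ↦ ?_) fun a ha ↦ ?_
  · simp only [mem_filter_univ] at hr ⊢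
    exact hr.1
  · simp only [mem_filter_univ] at ha
    have hσa : σ a ≠ 0 := by simpa using ha
    rw [← card_norm_eq hF hσ (mul_ne_zero ha hσa) (by rw [map_mul, hinv, mul_comm]), filter_filter]
    refine card_bij' (fun r _ ↦ r.2) (fun b _ ↦ (a, b)) ?_ ?_ ?_ ?_
    · rintro ⟨a', b⟩ h
      simp only [mem_filter_univ] at h ⊢
      obtain ⟨⟨-, h⟩, rfl⟩ := h
      exact h.symm
    · intro b h
      simp only [mem_filter_univ] at h ⊢
      exact ⟨⟨ha, h.symm⟩, trivial⟩
    · rintro ⟨a', b⟩ h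
      simp only [mem_filter_univ] at h
      rw [h.2]
    · simp

theorem card_anisotropic (hF : Fintype.card F = q ^ 2) (hσ : ∀ x, σ x = x ^ q) :
    #{r : F × F | r.1 * σ r.1 ≠ r.2 * σ r.2} = (q ^ 2 - 1) * (q ^ 2 - q) := by
  have hq := one_lt_of_card_eq_sq hF
  have h1 := card_filter_add_card_filter_not (s := (univ : Finset (F × F)))
    (fun r ↦ r.1 * σ r.1 = r.2 * σ r.2)
  have h2 : ({r : F × F | r.1 * σ r.1 = r.2 * σ r.2} : Finset (F × F)) =
      insert (0, 0) ({r : F × F | r.1 ≠ 0 ∧ r.1 * σ r.1 = r.2 * σ r.2} : Finset (F × F)) := by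
    ext ⟨a, b⟩
    simp only [mem_filter_univ, mem_insert, Prod.mk.injEq]
    by_cases ha : a = 0
    · subst ha
      simp [@eq_comm F 0]
    · simp [ha]
  rw [h2, card_insert_of_notMem (by simp), card_isotropic hF hσ, card_univ, Fintype.card_prod,
    hF] at h1
  obtain ⟨k, rfl⟩ : ∃ k, q = k + 1 := ⟨q - 1, by omega⟩
  have e1 : (k + 1) ^ 2 - 1 = k ^ 2 + 2 * k := by
    rw [Nat.sub_eq_iff_eq_add (by nlinarith)]; ring
  have e2 : (k + 1) ^ 2 - (k + 1) = k ^ 2 + k := by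
    rw [Nat.sub_eq_iff_eq_add (by nlinarith)]; ring
  rw [e1] at h1
  rw [e1, e2]
  simp only [ne_eq]
  linarith

end FiniteField

section Points

open Finset FiniteField

variable {F : Type*} [Field F]

theorem Qf_smul (a : F) (v : Fin 4 → F) : Qf (a • v) = a ^ 2 * Qf v := by
  simp only [Qf, Pi.smul_apply, smul_eq_mul]
  ring

theorem Hf_smul (q : ℕ) (a : F) (v : Fin 4 → F) : Hf q (a • v) = a ^ (q + 1) * Hf q v := by
  simp only [Hf, Pi.smul_apply, smul_eq_mul, mul_pow]
  ring

theorem Fline_smul {a : F} (ha : a ≠ 0) (v : Fin 4 → F) : Fline (a • v) = Fline v := by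
  ext x
  constructor
  · rintro ⟨b, rfl⟩
    exact ⟨b * a, by rw [mul_smul]⟩
  · rintro ⟨b, rfl⟩
    exact ⟨b / a, by rw [smul_smul, div_mul_cancel₀ _ ha]⟩

theorem exists_smul_of_Fline_eq {v w : Fin 4 → F} (hw : w ≠ 0) (h : Fline w = Fline v) :
    ∃ a : F, a ≠ 0 ∧ w = a • v := by
  obtain ⟨a, ha⟩ : w ∈ Fline v := h ▸ ⟨1, (one_smul F w).symm⟩
  refine ⟨a, ?_, ha⟩
  rintro rfl
  exact hw (by rw [ha, zero_smul])

/-- A set of nonzero vectors closed under nonzero scalars has `|F| - 1` vectors on each of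
its lines. -/
theorem ncard_Fline_mul [Fintype F] (P : (Fin 4 → F) → Prop) [DecidablePred P]
    (hP0 : ∀ v, P v → v ≠ 0) (hP : ∀ (a : F) v, a ≠ 0 → P v → P (a • v)) :
    Set.ncard {L : Set (Fin 4 → F) | ∃ v, P v ∧ L = Fline v} * (Fintype.card F - 1) =
      #{v | P v} := by
  classical
  have hset : {L : Set (Fin 4 → F) | ∃ v, P v ∧ L = Fline v} =
      (({v | P v} : Finset (Fin 4 → F)).image Fline : Finset (Set (Fin 4 → F))) := by
    ext L
    simp [eq_comm]
  rw [hset, Set.ncard_coe_finset]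
  symm
  refine card_eq_card_mul_of_card_fiber Fline (fun v hv ↦ mem_image_of_mem _ hv) fun L hL ↦ ?_
  obtain ⟨v, hv, rfl⟩ := mem_image.1 hL
  rw [mem_filter_univ] at hv
  have hfib : ({w ∈ ({v | P v} : Finset (Fin 4 → F)) | Fline w = Fline v} : Finset (Fin 4 → F)) =
      (univ.erase (0 : F)).image (· • v) := by
    ext w
    simp only [mem_filter, mem_univ, true_and, mem_image, mem_erase, and_true]
    constructor
    · rintro ⟨hw, h⟩
      obtain ⟨a, ha, rfl⟩ := exists_smul_of_Fline_eq (hP0 w hw) h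
      exact ⟨a, ha, rfl⟩
    · rintro ⟨a, ha, rfl⟩
      exact ⟨hP a v ha hv, Fline_smul ha v⟩
  rw [hfib, card_image_of_injective _ (smul_left_injective F (hP0 v hv)),
    card_erase_of_mem (mem_univ _), card_univ]

theorem card_vectors [Fintype F] [DecidableEq F] {q : ℕ} {σ : F →+* F}
    (hF : Fintype.card F = q ^ 2) (hodd : Odd q) (hσ : ∀ x, σ x = x ^ q) (h2 : (2 : F) ≠ 0) {n : ℕ}
    (hn : q + 1 = 2 * n) {ξ s : F} (hξ : ξ ≠ 0) (hξσ : σ (ξ ^ 2) = ξ ^ 2) (hs0 : s ≠ 0)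
    (hsσ : σ s = s) (hs : 1 - (ξ ^ 2)⁻¹ = s ^ 2) :
    #{v : Fin 4 → F | Qf v ≠ 0 ∧ Hf q v = 2 * ξ * Qf v ^ n} =
      (q ^ 2 - 1) * (q + 1) * ((q - 1) * n * q) +
        (q ^ 2 - 1) * (q ^ 2 - q) * (n * (2 + (q - 3) * (q + 1))) := by
  have hH : ∀ v : Fin 4 → F,
      Hf q v = v 0 * σ (v 0) - v 1 * σ (v 1) - v 2 * σ (v 2) + v 3 * σ (v 3) := by
    intro v
    simp only [Hf, hσ, pow_succ' _ q]
  have hfib : ∀ (R : F × F → Prop) [DecidablePred R] (r : F × F), R r →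
      #{v ∈ ({v ∈ ({v : Fin 4 → F | Qf v ≠ 0 ∧ Hf q v = 2 * ξ * Qf v ^ n} : Finset (Fin 4 → F)) |
        R (v 0, v 1)} : Finset (Fin 4 → F)) | (v 0, v 1) = r} =
      #{p : F × F | r.1 * p.2 - r.2 * p.1 ≠ 0 ∧
        r.1 * σ r.1 - r.2 * σ r.2 - p.1 * σ p.1 + p.2 * σ p.2 =
          2 * ξ * (r.1 * p.2 - r.2 * p.1) ^ n} := by
    rintro R _ ⟨a, b⟩ hr
    refine card_bij' (fun v _ ↦ (v 2, v 3)) (fun p _ ↦ ![a, b, p.1, p.2]) ?_ ?_ ?_ ?_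
    · intro v hv
      simp only [mem_filter, mem_univ, true_and, Prod.mk.injEq, hH, Qf] at hv ⊢
      obtain ⟨⟨hv, -⟩, rfl, rfl⟩ := hv
      exact hv
    · rintro ⟨c, d⟩ hp
      simp only [mem_filter, mem_univ, true_and, Prod.mk.injEq, hH, Qf] at hp ⊢
      exact ⟨⟨hp, hr⟩, rfl, rfl⟩
    · intro v hv
      simp only [mem_filter, mem_univ, true_and, Prod.mk.injEq] at hv
      obtain ⟨-, rfl, rfl⟩ := hv
      ext i
      fin_cases i <;> rfl
    · intro p _
      rfl
  rw [← card_filter_add_card_filter_not (fun v : Fin 4 → F ↦ v 0 * σ (v 0) = v 1 * σ (v 1)),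
    ← card_isotropic hF hσ, ← card_anisotropic hF hσ]
  congr 1
  · refine card_eq_card_mul_of_card_fiber (fun v ↦ (v 0, v 1)) ?_ ?_
    · intro v hv
      simp only [mem_filter, mem_univ, true_and] at hv ⊢
      refine ⟨fun h0 ↦ hv.1.1 ?_, hv.2⟩
      have h1 : v 1 = 0 := by simpa [h0] using hv.2
      simp [Qf, h0, h1]
    · intro r hr
      rw [mem_filter_univ] at hr
      rw [← card_completions_of_isotropic hF hodd hσ h2 hn hξ hξσ hr.1 hr.2]
      exact hfib (fun r ↦ r.1 * σ r.1 = r.2 * σ r.2) r hr.2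
  · refine card_eq_card_mul_of_card_fiber (fun v ↦ (v 0, v 1)) ?_ ?_
    · intro v hv
      simp only [mem_filter, mem_univ, true_and] at hv ⊢
      exact hv.2
    · intro r hr
      rw [mem_filter_univ] at hr
      rw [← card_completions_of_anisotropic hF hσ h2 hn hξ hs0 hsσ hs hξσ hr]
      exact hfib (fun r ↦ ¬ r.1 * σ r.1 = r.2 * σ r.2) r hr

theorem exists_ringHom_eq_pow [Fintype F] {q : ℕ} (hq : ∃ p k : ℕ, p.Prime ∧ 0 < k ∧ q = p ^ k)
    (hF : Fintype.card F = q ^ 2) : ∃ σ : F →+* F, ∀ x, σ x = x ^ q := by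
  obtain ⟨p, k, hp, hk, rfl⟩ := hq
  obtain ⟨r, hr, n, hrp, hn⟩ := FiniteField.card' F
  have hpr : p ∣ r ^ (n : ℕ) := by
    rw [← hn, hF, ← pow_mul]
    exact dvd_pow_self p (by positivity)
  obtain rfl := (Nat.prime_dvd_prime_iff_eq hp hrp).1 (hp.dvd_of_dvd_pow hpr)
  have : ExpChar F p := ExpChar.prime hp
  exact ⟨iterateFrobenius F p k, fun x ↦ iterateFrobenius_def p k x⟩

theorem two_ne_zero_of_card_eq_sq [Fintype F] {q : ℕ} (hodd : Odd q)
    (hF : Fintype.card F = q ^ 2) : (2 : F) ≠ 0 := by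
  have h : ringChar F ≠ 2 := by
    rw [Ne, FiniteField.even_card_iff_char_two, hF, ← Nat.even_iff]
    exact Nat.not_even_iff_odd.2 hodd.pow
  exact Ring.two_ne_zero h

end Points

/-- For `ξ ∈ Z₁` the point set `S̃_ξ = S_ξ \ H` has exactly `(q-1)²q²(q+1)/2` points. -/
theorem stmt15 (q : ℕ) (hq : ∃ p k : ℕ, p.Prime ∧ 0 < k ∧ q = p ^ k) (hodd : Odd q)
    (F : Type*) [Field F] [Fintype F] (hF : Fintype.card F = q ^ 2)
    (ξ : F) (hξ : ξ ∈ Zone q F) :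
    Set.ncard {L : Set (Fin 4 → F) | ∃ v : Fin 4 → F, v ≠ 0 ∧
      Hf q v = 2 * ξ * Qf v ^ ((q + 1) / 2) ∧ Hf q v ≠ 0 ∧ L = Fline v} =
      (q - 1) ^ 2 * q ^ 2 * (q + 1) / 2 := by
  classical
  obtain ⟨σ, hσ⟩ := exists_ringHom_eq_pow hq hF
  have h2 := two_ne_zero_of_card_eq_sq hodd hF
  have hq1 := FiniteField.one_lt_of_card_eq_sq hF
  obtain ⟨hξ0, -, -, s, hsσ, hs0, hs⟩ := hξ
  rw [← hσ] at hsσ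
  have hξσ : σ (ξ ^ 2) = ξ ^ 2 := by
    have h : (ξ ^ 2)⁻¹ = 1 - s ^ 2 := by rw [← hs]; ring
    rw [← inv_inj, ← map_inv₀, h, map_sub, map_one, map_pow, hsσ]
  obtain ⟨k, rfl⟩ := hodd
  obtain ⟨u, rfl⟩ : ∃ u, k = u + 1 := ⟨k - 1, by omega⟩
  have hn : (2 * (u + 1) + 1 + 1) / 2 = u + 2 := by omega
  have hn2 : 2 * (u + 1) + 1 + 1 = 2 * (u + 2) := by omega
  have hvec := card_vectors hF ⟨u + 1, rfl⟩ hσ h2 hn2 hξ0 hξσ hs0 hsσ hs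
  have hpred : ∀ v : Fin 4 → F, (v ≠ 0 ∧ Hf (2 * (u + 1) + 1) v = 2 * ξ * Qf v ^ (u + 2) ∧
      Hf (2 * (u + 1) + 1) v ≠ 0) ↔
      (Qf v ≠ 0 ∧ Hf (2 * (u + 1) + 1) v = 2 * ξ * Qf v ^ (u + 2)) := by
    intro v
    constructor
    · rintro ⟨-, h, h0⟩
      refine ⟨fun hQ ↦ h0 ?_, h⟩
      rw [h, hQ, zero_pow (by omega), mul_zero]
    · rintro ⟨hQ, h⟩
      refine ⟨?_, h, ?_⟩
      · rintro rfl
        simp [Qf] at hQ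
      · rw [h]
        exact mul_ne_zero (mul_ne_zero h2 hξ0) (pow_ne_zero _ hQ)
  have hlines := ncard_Fline_mul
    (fun v : Fin 4 → F ↦ Qf v ≠ 0 ∧ Hf (2 * (u + 1) + 1) v = 2 * ξ * Qf v ^ (u + 2))
    (fun v hv ↦ ((hpred v).2 hv).1) (by
      rintro a v ha ⟨hQ, h⟩
      rw [Qf_smul, Hf_smul, h]
      refine ⟨mul_ne_zero (pow_ne_zero _ ha) hQ, ?_⟩
      rw [hn2]
      ring)
  rw [hvec, hF] at hlines
  have hset : {L : Set (Fin 4 → F) | ∃ v : Fin 4 → F, v ≠ 0 ∧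
      Hf (2 * (u + 1) + 1) v = 2 * ξ * Qf v ^ ((2 * (u + 1) + 1 + 1) / 2) ∧
      Hf (2 * (u + 1) + 1) v ≠ 0 ∧ L = Fline v} =
      {L | ∃ v, (Qf v ≠ 0 ∧ Hf (2 * (u + 1) + 1) v = 2 * ξ * Qf v ^ (u + 2)) ∧ L = Fline v} := by
    ext L
    simp only [Set.mem_ofPred_eq, ← hpred, hn, and_assoc]
  rw [hset]
  have e1 : (2 * (u + 1) + 1) ^ 2 - 1 = 4 * u ^ 2 + 12 * u + 8 := by
    rw [Nat.sub_eq_iff_eq_add (by nlinarith)]; ring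
  have e2 : (2 * (u + 1) + 1) ^ 2 - (2 * (u + 1) + 1) = 4 * u ^ 2 + 10 * u + 6 := by
    rw [Nat.sub_eq_iff_eq_add (by nlinarith)]; ring
  have e3 : 2 * (u + 1) + 1 - 3 = 2 * u := by omega
  have e4 : 2 * (u + 1) + 1 - 1 = 2 * u + 2 := by omega
  rw [e1, e2, e3, e4] at hlines
  rw [e4, hn2, ← mul_assoc, mul_right_comm, Nat.mul_div_cancel _ (by norm_num)]
  refine Nat.eq_of_mul_eq_mul_right (show 0 < 4 * u ^ 2 + 12 * u + 8 by positivity) ?_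
  rw [hlines]
  ring
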